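/- arXiv:1710.02817 — 2 statements merged into one kernel-verified Lean document; each statement's English description precedes it below -/
import Mathlib

section
/- (Correctness of the reduction from Shortest Common Supersequence to String Aligning.) Let C be a type of ordinary characters, S a finite nonempty family of strings over C, and k a natural number. Let s_n be the string consisting of k copies of c_n, and let S_SAP be the family S together with s_n, viewed as strings over α. Then there exists a string s' over C with length(s') ≤ k such that every string in S is a subsequence of s' if and only if there exists an alignment P of S_SAP with size(P) ≤ k. -/
/-- The character type of the reduction: ordinary characters `C` together with two
further distinct symbols `cn` and `null`. -/
inductive SapChar (C : Type*) : Type _ where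
  | chr : C → SapChar C
  | cn : SapChar C
  | null : SapChar C
  deriving DecidableEq

/-- The distance of the reduction: `d a b = 0` if `a = b`; `1` if `a ≠ b` and
`null ∈ {a, b}`; `1` if `a ≠ b`, `null ∉ {a, b}` and `cn ∈ {a, b}`; `2` otherwise. -/
def sapDist {C : Type*} [DecidableEq C] (a b : SapChar C) : ℝ :=
  if a = b then 0
  else if a = SapChar.null ∨ b = SapChar.null then 1
  else if a = SapChar.cn ∨ b = SapChar.cn then 1
  else 2

/-- `sapDist` is a metric on `SapChar C`. -/
noncomputable instance {C : Type*} [DecidableEq C] : MetricSpace (SapChar C) where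
  dist := sapDist
  dist_self a := by simp [sapDist]
  dist_comm a b := by
    show sapDist a b = sapDist b a
    unfold sapDist
    split_ifs <;> simp_all [eq_comm, or_comm]
  dist_triangle a b c := by
    show sapDist a c ≤ sapDist a b + sapDist b c
    unfold sapDist
    split_ifs <;> subst_vars <;> simp_all <;> norm_num
  eq_of_dist_eq_zero := by
    intro a b h
    replace h : sapDist a b = 0 := h
    unfold sapDist at h
    split_ifs at h <;> first | assumption | norm_num at h

/-- The size of a paradigm `P : I → Fin m → α`: the sum over columns of the metric
diameter of the column set `P[i] = {P t i : t ∈ I}`. -/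
noncomputable def psize {α : Type*} [PseudoMetricSpace α] {I : Type*} {m : ℕ}
    (P : I → Fin m → α) : ℝ :=
  ∑ i : Fin m, Metric.diam (Set.range fun t => P t i)

/-- `P` is an alignment of the family of strings `S`: for each index `t` there is a
strictly monotone map `f` of the positions of `S t` into the columns of `P` such that
row `t` of `P` agrees with `S t` along `f` and is `null` on all other columns. -/
def IsAlignment {α : Type*} (null : α) {I : Type*} {m : ℕ}
    (S : I → List α) (P : I → Fin m → α) : Prop :=
  ∀ t, ∃ f : Fin (S t).length → Fin m, StrictMono f ∧
    (∀ i, P t (f i) = (S t).get i) ∧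
    ∀ j, j ∉ Set.range f → P t j = null

/-- The family `S_SAP`: the strings of `S` (over the ordinary characters) together with
the string consisting of `k` copies of `cn`. -/
def sapFamily {C : Type*} {I : Type*} (S : I → List C) (k : ℕ) :
    Option I → List (SapChar C) :=
  fun o => o.elim (List.replicate k SapChar.cn) (fun t => (S t).map SapChar.chr)

theorem sapFamily_none_get {C I : Type*} (S : I → List C) (k : ℕ)
    (i : Fin (sapFamily S k none).length) : (sapFamily S k none).get i = SapChar.cn :=
  List.getElem_replicate i.isLt

theorem length_sapFamily_some {C I : Type*} (S : I → List C) (k : ℕ) (t : I) :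
    (sapFamily S k (some t)).length = (S t).length :=
  List.length_map _

theorem sapFamily_some_get {C I : Type*} (S : I → List C) (k : ℕ) (t : I)
    (i : Fin (sapFamily S k (some t)).length) :
    (sapFamily S k (some t)).get i =
      SapChar.chr ((S t).get (i.cast (length_sapFamily_some S k t))) :=
  List.getElem_map _

theorem SapChar.dist_cn_le_one {C : Type*} [DecidableEq C] (a : SapChar C) :
    dist SapChar.cn a ≤ 1 := by
  change sapDist _ _ ≤ 1
  unfold sapDist
  split_ifs <;> simp_all

theorem SapChar.dist_null_le_one {C : Type*} [DecidableEq C] (a : SapChar C) :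
    dist SapChar.null a ≤ 1 := by
  change sapDist _ _ ≤ 1
  unfold sapDist
  split_ifs <;> simp_all

theorem SapChar.one_le_dist {C : Type*} [DecidableEq C] {a b : SapChar C} (h : a ≠ b) :
    1 ≤ dist a b := by
  change 1 ≤ sapDist a b
  unfold sapDist
  split_ifs <;> simp_all

theorem SapChar.dist_chr_chr {C : Type*} [DecidableEq C] {a b : C} (h : a ≠ b) :
    dist (SapChar.chr a) (SapChar.chr b) = 2 := by
  change sapDist _ _ = 2
  simp [sapDist, h]

/-- A strictly increasing sequence of positions selects a sublist of all positions. -/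
theorem List.map_finRange_sublist {n m : ℕ} {f : Fin n → Fin m} (hf : StrictMono f) :
    ((List.finRange n).map f).Sublist (List.finRange m) := by
  have hs : ((List.finRange n).map f).Pairwise (· < ·) :=
    List.Pairwise.map f (fun _ _ h => hf h) (List.pairwise_lt_finRange n)
  refine List.sublist_of_subperm_of_pairwise
    (List.subperm_of_subset (hs.imp fun h => h.ne) fun j _ => List.mem_finRange j) hs
    (List.pairwise_lt_finRange m)

/-- If a partial map sends the positions `f 0 < f 1 < ⋯` to the successive entries of `l`,
then `l` is a subsequence of the list of all values of the partial map. -/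
theorem List.sublist_filterMap_finRange {β : Type*} {m : ℕ} (l : List β) (g : Fin m → Option β)
    {f : Fin l.length → Fin m} (hf : StrictMono f) (hg : ∀ i, g (f i) = some (l.get i)) :
    l.Sublist ((List.finRange m).filterMap g) := by
  have h := (List.map_finRange_sublist hf).filterMap g
  rw [List.filterMap_map, show g ∘ f = some ∘ l.get from funext hg,
    List.filterMap_eq_map, List.map_get_finRange] at h
  exact h

/-- A family with a common supersequence of length at most `k` has an alignment, together with
`k` copies of `cn`, of size at most `k`. -/
theorem exists_alignment_of_supersequence {C : Type*} [DecidableEq C] {I : Type*}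
    (S : I → List C) (k : ℕ) (s' : List C) (hk : s'.length ≤ k) (hs : ∀ t, (S t).Sublist s') :
    ∃ (m : ℕ) (P : Option I → Fin m → SapChar C),
      IsAlignment SapChar.null (sapFamily S k) P ∧ psize P ≤ (k : ℝ) := by
  classical
  choose e he using fun t => List.sublist_iff_exists_fin_orderEmbedding_get_eq.mp (hs t)
  let x : Fin k → SapChar C := fun j => (s'[(j : ℕ)]?).elim SapChar.null SapChar.chr
  let P : Option I → Fin k → SapChar C := fun o j => o.elim SapChar.cn fun t =>
    if ∃ i, (e t i : ℕ) = j then x j else SapChar.null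
  have hP : ∀ o j, P o j = SapChar.cn ∨ P o j = SapChar.null ∨ P o j = x j := by
    rintro (_ | t) j
    · exact Or.inl rfl
    · by_cases h : ∃ i, (e t i : ℕ) = j
      · exact Or.inr (Or.inr (if_pos h))
      · exact Or.inr (Or.inl (if_neg h))
  refine ⟨k, P, ?_, ?_⟩
  · rintro (_ | t)
    · refine ⟨Fin.cast (by simp [sapFamily]), fun i j h => h, fun i => ?_, fun j hj => ?_⟩
      · exact (sapFamily_none_get S k i).symm
      · exact absurd ⟨Fin.cast (by simp [sapFamily]) j, rfl⟩ hj
    · have hlen := length_sapFamily_some S k t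
      refine ⟨fun i => (e t (i.cast hlen)).castLE hk,
        fun i j h => (e t).strictMono (show i.cast hlen < j.cast hlen from h),
        fun i => ?_, fun j hj => ?_⟩
      · have h := he t (i.cast hlen)
        have hx : x ((e t (i.cast hlen)).castLE hk) = SapChar.chr ((S t).get (i.cast hlen)) := by
          rw [h]
          simp [x]
        refine (if_pos ⟨i.cast hlen, rfl⟩).trans (hx.trans (sapFamily_some_get S k t i).symm)
      · refine if_neg ?_
        rintro ⟨i, hi⟩
        exact hj ⟨i.cast hlen.symm, Fin.ext hi⟩
  · have hd : ∀ j, Metric.diam (Set.range fun t => P t j) ≤ 1 := by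
      intro j
      refine Metric.diam_le_of_forall_dist_le zero_le_one ?_
      rintro _ ⟨o, rfl⟩ _ ⟨o', rfl⟩
      rcases hP o j with h | h | h <;> rcases hP o' j with h' | h' | h' <;>
        simp only [h, h', SapChar.dist_cn_le_one, SapChar.dist_null_le_one, dist_self,
          zero_le_one, dist_comm (x j)]
    simpa [psize] using Finset.sum_le_sum fun j (_ : j ∈ Finset.univ) => hd j

/-- If `S` together with `k` copies of `cn` has an alignment of size at most `k`, then the
columns containing `cn` have diameter `1` and all others have diameter `0`. -/
theorem diam_column_of_psize_le {C : Type*} [DecidableEq C] {I : Type*}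
    [Finite I] [Nonempty I] {S : I → List C} {k m : ℕ} {P : Option I → Fin m → SapChar C}
    (hP : IsAlignment SapChar.null (sapFamily S k) P) (hsize : psize P ≤ (k : ℝ)) :
    ∃ A : Finset (Fin m), A.card = k ∧ (∀ j ∉ A, P none j = SapChar.null) ∧
      ∀ j, Metric.diam (Set.range fun t => P t j) = if j ∈ A then 1 else 0 := by
  obtain ⟨f, hf, hget, hnull⟩ := hP none
  have hA : (Finset.univ.image f).card = k := by
    rw [Finset.card_image_of_injective _ hf.injective, Finset.card_univ, Fintype.card_fin]
    exact List.length_replicate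
  refine ⟨Finset.univ.image f, hA, fun j hj => hnull j (by simpa using hj), ?_⟩
  have hle : ∀ j ∈ Finset.univ, (if j ∈ Finset.univ.image f then (1 : ℝ) else 0) ≤
      Metric.diam (Set.range fun t => P t j) := by
    intro j _
    split_ifs with hj
    · obtain ⟨i, -, rfl⟩ := Finset.mem_image.mp hj
      have hcn : P none (f i) = SapChar.cn := (hget i).trans (sapFamily_none_get S k i)
      obtain ⟨t⟩ := ‹Nonempty I›
      obtain ⟨g, -, hgget, hgnull⟩ := hP (some t)
      have hne : P none (f i) ≠ P (some t) (f i) := by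
        rw [hcn]
        by_cases h : f i ∈ Set.range g
        · obtain ⟨i', hi'⟩ := h
          rw [← hi', hgget, sapFamily_some_get]
          simp
        · rw [hgnull _ h]
          simp
      exact (SapChar.one_le_dist hne).trans <| Metric.dist_le_diam_of_mem
        (Set.finite_range _).isBounded ⟨none, rfl⟩ ⟨some t, rfl⟩
    · exact Metric.diam_nonneg
  have hsum : ∑ j, (if j ∈ Finset.univ.image f then (1 : ℝ) else 0) = k := by
    rw [Finset.sum_ite_mem, Finset.univ_inter, Finset.sum_const, hA, nsmul_one]
  have heq := (Finset.sum_eq_sum_iff_of_le hle).mp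
    (le_antisymm (Finset.sum_le_sum hle) (hsize.trans hsum.ge))
  exact fun j => (heq j (Finset.mem_univ j)).symm

/-- If `S` together with `k` copies of `cn` has an alignment of size at most `k`, then `S` has
a common supersequence of length at most `k`. -/
theorem exists_supersequence_of_alignment {C : Type*} [DecidableEq C] {I : Type*}
    [Finite I] [Nonempty I] {S : I → List C} {k m : ℕ} {P : Option I → Fin m → SapChar C}
    (hP : IsAlignment SapChar.null (sapFamily S k) P) (hsize : psize P ≤ (k : ℝ)) :
    ∃ s' : List C, s'.length ≤ k ∧ ∀ t, (S t).Sublist s' := by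
  classical
  obtain ⟨A, hA, hnull, hdiam⟩ := diam_column_of_psize_le hP hsize
  have hdist : ∀ o o' j, dist (P o j) (P o' j) ≤ if j ∈ A then 1 else 0 := fun o o' j =>
    hdiam j ▸ Metric.dist_le_diam_of_mem (Set.finite_range _).isBounded ⟨o, rfl⟩ ⟨o', rfl⟩
  have hmem : ∀ o j c, P o j = SapChar.chr c → j ∈ A := by
    intro o j c h
    by_contra hj
    have h1 := hdist o none j
    rw [if_neg hj, h, hnull j hj] at h1
    linarith [SapChar.one_le_dist (a := SapChar.chr c) (b := SapChar.null) (by simp)]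
  have huniq : ∀ o o' j c c', P o j = SapChar.chr c → P o' j = SapChar.chr c' → c = c' := by
    intro o o' j c c' h h'
    by_contra hne
    have h1 := hdist o o' j
    rw [if_pos (hmem o j c h), h, h', SapChar.dist_chr_chr hne] at h1
    norm_num at h1
  let g : Fin m → Option C := fun j =>
    if h : ∃ c o, P o j = SapChar.chr c then some h.choose else none
  have hg : ∀ o j c, P o j = SapChar.chr c → g j = some c := by
    intro o j c h
    have hex : ∃ c o, P o j = SapChar.chr c := ⟨c, o, h⟩
    obtain ⟨o', h'⟩ := hex.choose_spec
    exact (dif_pos hex).trans (congrArg some (huniq o' o j _ _ h' h))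
  refine ⟨(List.finRange m).filterMap g, ?_, fun t => ?_⟩
  · calc ((List.finRange m).filterMap g).length
        = (List.finRange m).countP fun j => (g j).isSome := List.length_filterMap_eq_countP
      _ ≤ (List.finRange m).countP fun j => j ∈ A := by
          refine List.countP_mono_left fun j _ hj => ?_
          by_cases h : ∃ c o, P o j = SapChar.chr c
          · obtain ⟨c, o, h⟩ := h
            simpa using hmem o j c h
          · simp [g, h] at hj
      _ = A.card := by
          rw [List.countP_eq_length_filter, ← List.toFinset_card_of_nodup
            ((List.nodup_finRange m).filter _)]
          congr 1
          ext j
          simp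
      _ = k := hA
  · obtain ⟨f, hf, hget, -⟩ := hP (some t)
    have hlen := (length_sapFamily_some S k t).symm
    refine List.sublist_filterMap_finRange (S t) g (f := fun i => f (i.cast hlen))
      (fun i j h => hf (show i.cast hlen < j.cast hlen from h)) fun i => ?_
    exact hg (some t) _ _ ((hget _).trans (sapFamily_some_get S k t _))

/-- **Correctness of the reduction from SCS to String Aligning.**
There exists a string `s'` over `C` with `length s' ≤ k` such that every string of the
nonempty family `S` is a subsequence of `s'`, if and only if there exists an alignment
`P` of `S_SAP` with `size P ≤ k`. -/
theorem scs_to_sap_correct {C : Type*} [DecidableEq C] {I : Type*}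
    [Fintype I] [Nonempty I] (S : I → List C) (k : ℕ) :
    (∃ s' : List C, s'.length ≤ k ∧ ∀ t, (S t).Sublist s') ↔
    (∃ (m : ℕ) (P : Option I → Fin m → SapChar C),
      IsAlignment SapChar.null (sapFamily S k) P ∧ psize P ≤ (k : ℝ)) := by
  exact ⟨fun ⟨s', hk, hs⟩ => exists_alignment_of_supersequence S k s' hk hs,
    fun ⟨_, _, hP, hsize⟩ => exists_supersequence_of_alignment hP hsize⟩
end

section
/- In the reduction from Shortest Common Supersequence to String Aligning, if the family S of strings over C is nonempty, then every alignment P of S_SAP (the family S together with the string s_n of k copies of c_n) satisfies size(P) ≥ k. -/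
/-- A position of an aligned row holds either a character of the string or `null`. -/
theorem IsAlignment.mem_or_eq_null {α : Type*} {null : α} {I : Type*} {m : ℕ}
    {S : I → List α} {P : I → Fin m → α} (hP : IsAlignment null S P) (t : I) (j : Fin m) :
    P t j ∈ S t ∨ P t j = null := by
  obtain ⟨f, -, hf, hnull⟩ := hP t
  by_cases hj : j ∈ Set.range f
  · obtain ⟨i, rfl⟩ := hj
    exact Or.inl (hf i ▸ List.get_mem _ i)
  · exact Or.inr (hnull j hj)

theorem SapChar.dist_cn_of_ne {C : Type*} [DecidableEq C] {a : SapChar C}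
    (ha : a ≠ SapChar.cn) : dist SapChar.cn a = 1 := by
  change sapDist SapChar.cn a = 1
  simp [sapDist, ha.symm]

/-- If an injection from `ι` hits only columns of diameter at least `1`, then the size of the
paradigm is at least the cardinality of `ι`. -/
theorem card_le_psize {α : Type*} [PseudoMetricSpace α] {I ι : Type*} [Fintype ι] {m : ℕ}
    (P : I → Fin m → α) {f : ι → Fin m} (hf : Function.Injective f)
    (h : ∀ i, 1 ≤ Metric.diam (Set.range fun t => P t (f i))) :
    (Fintype.card ι : ℝ) ≤ psize P := by
  calc (Fintype.card ι : ℝ) = ∑ _i : ι, (1 : ℝ) := by simp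
    _ ≤ ∑ i, Metric.diam (Set.range fun t => P t (f i)) := Finset.sum_le_sum fun i _ => h i
    _ = ∑ j ∈ Finset.univ.map ⟨f, hf⟩, Metric.diam (Set.range fun t => P t j) := by simp
    _ ≤ psize P := Finset.sum_le_sum_of_subset_of_nonneg (Finset.subset_univ _)
        fun _ _ _ => Metric.diam_nonneg

/-- In the reduction from SCS to String Aligning, if the family `S`
of strings over `C` is nonempty, then every alignment `P` of `S_SAP` (the family `S`
together with the string of `k` copies of `cn`) satisfies `size P ≥ k`. -/
theorem sap_size_ge {C : Type*} [DecidableEq C] {I : Type*}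
    [Fintype I] [Nonempty I] (S : I → List C) (k : ℕ)
    {m : ℕ} (P : Option I → Fin m → SapChar C)
    (hP : IsAlignment SapChar.null (sapFamily S k) P) :
    (k : ℝ) ≤ psize P := by
  obtain ⟨f, hf, hcn, -⟩ := hP none
  obtain ⟨t⟩ := ‹Nonempty I›
  have hlen : (sapFamily S k none).length = k := by simp [sapFamily]
  have h : ∀ i, 1 ≤ Metric.diam (Set.range fun o => P o (f i)) := by
    intro i
    have hnone : P none (f i) = SapChar.cn :=
      List.eq_of_mem_replicate (hcn i ▸ List.get_mem _ i)
    have hsome : P (some t) (f i) ≠ SapChar.cn := by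
      rcases hP.mem_or_eq_null (some t) (f i) with hmem | hnull
      · obtain ⟨c, -, hc⟩ := List.mem_map.mp hmem
        simp [← hc]
      · simp [hnull]
    rw [← SapChar.dist_cn_of_ne hsome, ← hnone]
    exact Metric.dist_le_diam_of_mem (Set.finite_range _).isBounded ⟨none, rfl⟩ ⟨some t, rfl⟩
  simpa [hlen] using card_le_psize P hf.injective h
end
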